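/- arXiv:2006.09997 — 3 statements merged into one kernel-verified Lean document; each statement's English description precedes it below -/
import Mathlib

section
/- For any mean reward vector μ : {1,…,K} → [0,1], resource amount C > 0, and common threshold θ_s ∈ (0, C], let M = min(⌊C/θ_s⌋, K) and θ̂_s = C/M. Then θ_s and θ̂_s are allocation equivalent, i.e. the supremum of Σ_{i=1}^K μ_i · 1{x_i ≥ θ_s} over all feasible allocations x equals the supremum of Σ_{i=1}^K μ_i · 1{x_i ≥ θ̂_s} over all feasible allocations x; moreover θ̂_s belongs to the finite set Θ = {C/K, C/(K−1), …, C/1}. -/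
/-- The utilities achieved by feasible allocations under a common positive threshold `θ` are the
total rewards of the sets of agents that can all be given `θ`. -/
theorem setOf_threshold_utility_eq {ι : Type*} [Fintype ι] (μ : ι → ℝ) {C θ : ℝ} (hθ : 0 < θ) :
    {u : ℝ | ∃ x : ι → ℝ, (∀ i, 0 ≤ x i) ∧ (∑ i, x i) ≤ C ∧
        u = ∑ i, if θ ≤ x i then μ i else 0} =
      {u : ℝ | ∃ S : Finset ι, (S.card : ℝ) * θ ≤ C ∧ u = ∑ i ∈ S, μ i} := by
  classical
  ext u
  constructor
  · rintro ⟨x, hx, hxC, rfl⟩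
    refine ⟨Finset.univ.filter fun i => θ ≤ x i, ?_, (Finset.sum_filter _ _).symm⟩
    calc ((Finset.univ.filter fun i => θ ≤ x i).card : ℝ) * θ
        ≤ ∑ i ∈ Finset.univ.filter fun i => θ ≤ x i, x i := by
          rw [← nsmul_eq_mul]
          exact Finset.card_nsmul_le_sum _ _ _ fun i hi => (Finset.mem_filter.mp hi).2
      _ ≤ ∑ i, x i :=
          Finset.sum_le_sum_of_subset_of_nonneg (Finset.filter_subset _ _) fun i _ _ => hx i
      _ ≤ C := hxC
  · rintro ⟨S, hS, rfl⟩
    refine ⟨fun i => if i ∈ S then θ else 0, fun i => ?_, ?_, ?_⟩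
    · dsimp only
      split_ifs
      exacts [hθ.le, le_rfl]
    · simpa [Finset.sum_ite_mem] using hS
    · rw [← Finset.sum_subset (Finset.subset_univ S) (fun i _ hi => by simp [hi, hθ])]
      exact Finset.sum_congr rfl fun i hi => by simp [hi]


/-- For any mean reward vector `μ : Fin K → [0,1]`, resource amount `C > 0`
and common threshold `θs ∈ (0, C]`, with `M = min ⌊C/θs⌋ K` and `θ̂s = C / M`, the thresholds
`θs` and `θ̂s` are allocation equivalent (the suprema of expected network utility over feasible
allocations coincide), and moreover `θ̂s ∈ {C/K, C/(K-1), …, C/1}`. -/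
theorem onum_same_threshold_allocation_equivalent
    (K : ℕ) (hK : 1 ≤ K) (μ : Fin K → ℝ) (hμ : ∀ i, μ i ∈ Set.Icc (0 : ℝ) 1)
    (C : ℝ) (hC : 0 < C) (θs : ℝ) (hθs : 0 < θs) (hθsC : θs ≤ C)
    (M : ℕ) (hM : M = min (⌊C / θs⌋₊) K)
    (θhat : ℝ) (hθhat : θhat = C / (M : ℝ)) :
    (sSup {u : ℝ | ∃ x : Fin K → ℝ, (∀ i, 0 ≤ x i) ∧ (∑ i, x i) ≤ C ∧
        u = ∑ i, if θs ≤ x i then μ i else 0} =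
      sSup {u : ℝ | ∃ x : Fin K → ℝ, (∀ i, 0 ≤ x i) ∧ (∑ i, x i) ≤ C ∧
        u = ∑ i, if θhat ≤ x i then μ i else 0}) ∧
    ∃ m : ℕ, 1 ≤ m ∧ m ≤ K ∧ θhat = C / (m : ℝ) := by
  have hMpos : 1 ≤ M := by
    rw [hM, le_min_iff, Nat.one_le_floor_iff, one_le_div hθs]
    exact ⟨hθsC, hK⟩
  have hM0 : (0 : ℝ) < M := by exact_mod_cast hMpos
  have hθhat_pos : 0 < θhat := hθhat ▸ div_pos hC hM0
  refine ⟨?_, M, hMpos, hM ▸ min_le_right _ _, hθhat⟩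
  rw [setOf_threshold_utility_eq μ hθs, setOf_threshold_utility_eq μ hθhat_pos]
  congr 1
  ext u
  refine exists_congr fun S => and_congr_left fun _ => ?_
  have hSK : S.card ≤ K := by simpa using S.card_le_univ
  calc (S.card : ℝ) * θs ≤ C ↔ S.card ≤ M := by
        rw [hM, le_min_iff, Nat.le_floor_iff (div_pos hC hθs).le, le_div_iff₀ hθs]
        exact (and_iff_left hSK).symm
    _ ↔ (S.card : ℝ) * θhat ≤ C := by
        rw [hθhat, ← mul_div_assoc, div_le_iff₀ hM0, mul_comm C, mul_le_mul_iff_left₀ hC,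
          Nat.cast_le]
end

section
/- Suppose the mean rewards are sorted in decreasing order, i.e. μ_1 ≥ μ_2 ≥ … ≥ μ_K, all agents share a common threshold θ_s ∈ (0, C], and let M = min(⌊C/θ_s⌋, K). Then the supremum of Σ_{i=1}^K μ_i · 1{x_i ≥ θ_s} over all feasible allocations x equals Σ_{i=1}^M μ_i, the sum of the M largest mean rewards, and this value is attained by allocating C/M to each of the top M agents. -/
/-- A set `T` whose values are at least `c ≥ 0`, outside of which values are at most `c`, has the
largest sum among all finite sets of at most its cardinality. -/
theorem Finset.sum_le_sum_of_threshold {ι : Type*} [DecidableEq ι] (f : ι → ℝ) (S T : Finset ι)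
    (c : ℝ) (hc : 0 ≤ c) (hcard : S.card ≤ T.card) (hT : ∀ i ∈ T, c ≤ f i)
    (hS : ∀ i ∉ T, f i ≤ c) : ∑ i ∈ S, f i ≤ ∑ i ∈ T, f i := by
  have h₁ : ∑ i ∈ S \ T, f i ≤ (S \ T).card * c := by
    simpa using Finset.sum_le_card_nsmul (S \ T) f c fun i hi => hS i (Finset.mem_sdiff.1 hi).2
  have h₂ : (T \ S).card * c ≤ ∑ i ∈ T \ S, f i := by
    simpa using Finset.card_nsmul_le_sum (T \ S) f c fun i hi => hT i (Finset.mem_sdiff.1 hi).1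
  have h₃ : ((S \ T).card : ℝ) * c ≤ (T \ S).card * c := by
    have : (S \ T).card ≤ (T \ S).card := Finset.card_sdiff_le_card_sdiff_iff.2 hcard
    gcongr
  have h₄ := Finset.sum_inter_add_sum_sdiff S T f
  have h₅ := Finset.sum_inter_add_sum_sdiff T S f
  rw [Finset.inter_comm] at h₅
  linarith

/-- At most `⌊C / θ⌋` coordinates of a nonnegative vector of total at most `C` reach `θ > 0`. -/
theorem Finset.card_filter_le_floor_div {ι : Type*} [Fintype ι] (x : ι → ℝ) (hx : ∀ i, 0 ≤ x i)
    (C θ : ℝ) (hθ : 0 < θ) (hsum : ∑ i, x i ≤ C) :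
    (Finset.univ.filter fun i => θ ≤ x i).card ≤ ⌊C / θ⌋₊ := by
  refine Nat.le_floor ((le_div_iff₀ hθ).2 (le_trans ?_ hsum))
  calc ((Finset.univ.filter fun i => θ ≤ x i).card : ℝ) * θ
      ≤ ∑ i ∈ Finset.univ.filter (fun i => θ ≤ x i), x i := by
        simpa using Finset.card_nsmul_le_sum (Finset.univ.filter fun i => θ ≤ x i) x θ
          fun i hi => (Finset.mem_filter.1 hi).2
    _ ≤ ∑ i, x i := Finset.sum_le_univ_sum_of_nonneg hx


/-- If the mean rewards are sorted in decreasing order, all agents share a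
common threshold `θs ∈ (0, C]`, and `M = min ⌊C/θs⌋ K`, then the supremum of the expected
network utility over all feasible allocations equals the sum of the `M` largest mean rewards
`∑_{i < M} μ i`, and this value is attained by the feasible allocation giving `C / M` to each
of the top `M` agents. -/
theorem onum_same_threshold_optimal_value
    (K : ℕ) (hK : 1 ≤ K) (μ : Fin K → ℝ) (hμ : ∀ i, μ i ∈ Set.Icc (0 : ℝ) 1)
    (hsorted : ∀ i j : Fin K, i ≤ j → μ j ≤ μ i)
    (C : ℝ) (hC : 0 < C) (θs : ℝ) (hθs : 0 < θs) (hθsC : θs ≤ C)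
    (M : ℕ) (hM : M = min (⌊C / θs⌋₊) K) :
    (sSup {u : ℝ | ∃ x : Fin K → ℝ, (∀ i, 0 ≤ x i) ∧ (∑ i, x i) ≤ C ∧
        u = ∑ i, if θs ≤ x i then μ i else 0} =
      ∑ i ∈ Finset.univ.filter (fun i : Fin K => (i : ℕ) < M), μ i) ∧
    ((∀ i : Fin K, 0 ≤ (if (i : ℕ) < M then C / (M : ℝ) else 0)) ∧
      (∑ i : Fin K, if (i : ℕ) < M then C / (M : ℝ) else 0) ≤ C ∧
      (∑ i : Fin K, if θs ≤ (if (i : ℕ) < M then C / (M : ℝ) else 0) then μ i else 0) =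
        ∑ i ∈ Finset.univ.filter (fun i : Fin K => (i : ℕ) < M), μ i) := by
  have hMK : M ≤ K := hM ▸ min_le_right _ _
  have hMpos : 0 < M := by
    rw [hM]
    exact lt_min (Nat.floor_pos.2 ((one_le_div hθs).2 hθsC)) hK
  have hMR : (0 : ℝ) < M := Nat.cast_pos.2 hMpos
  have hcard : (Finset.univ.filter fun i : Fin K => (i : ℕ) < M).card = M := by
    rw [Fin.card_filter_val_lt, min_eq_right hMK]
  have hθM : θs ≤ C / M := by
    have h₁ : (M : ℝ) ≤ C / θs :=
      le_trans (Nat.cast_le.2 (hM ▸ min_le_left _ _)) (Nat.floor_le (div_pos hC hθs).le)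
    rw [le_div_iff₀ hθs] at h₁
    rw [le_div_iff₀ hMR]
    linarith
  have hnonneg : ∀ i : Fin K, 0 ≤ (if (i : ℕ) < M then C / (M : ℝ) else 0) := by
    intro i
    split_ifs
    · positivity
    · exact le_rfl
  have hsum : (∑ i : Fin K, if (i : ℕ) < M then C / (M : ℝ) else 0) ≤ C := by
    rw [← Finset.sum_filter, Finset.sum_const, hcard, nsmul_eq_mul, mul_div_cancel₀ C hMR.ne']
  have hval : (∑ i : Fin K, if θs ≤ (if (i : ℕ) < M then C / (M : ℝ) else 0) then μ i else 0) =
      ∑ i ∈ Finset.univ.filter (fun i : Fin K => (i : ℕ) < M), μ i := by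
    rw [Finset.sum_filter]
    refine Finset.sum_congr rfl fun i _ => ?_
    by_cases h : (i : ℕ) < M
    · simp [h, hθM]
    · simp [h, hθs]
  refine ⟨IsGreatest.csSup_eq ⟨⟨_, hnonneg, hsum, hval.symm⟩, ?_⟩, hnonneg, hsum, hval⟩
  rintro u ⟨x, hx, hxC, rfl⟩
  rw [← Finset.sum_filter]
  refine Finset.sum_le_sum_of_threshold μ _ _ (μ ⟨M - 1, by omega⟩) (hμ _).1 ?_ ?_ ?_
  · rw [hcard, hM]
    refine le_min (Finset.card_filter_le_floor_div x hx C θs hθs hxC) ?_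
    simpa using Finset.card_le_univ (Finset.univ.filter fun i => θs ≤ x i)
  · intro i hi
    have hi' := (Finset.mem_filter.1 hi).2
    exact hsorted _ _ (Fin.le_def.2 (by simp only; omega))
  · intro i hi
    have hi' : ¬ (i : ℕ) < M := by simpa using hi
    exact hsorted _ _ (Fin.le_def.2 (by simp only; omega))
end

section
/- Let μ : {1,…,K} → [0,1], let θ : {1,…,K} → ℝ with θ_i ≥ 0 for all i, and let C ≥ 0. Let S⋆ ⊆ {1,…,K} be an optimal solution of the 0–1 knapsack problem with capacity C, weights θ and values μ, let l = C − Σ_{i∈S⋆} θ_i and γ = l/K, and assume γ > 0. If θ̂ : {1,…,K} → ℝ satisfies θ_i ≤ θ̂_i ≤ θ_i + γ for every i, then θ and θ̂ are allocation equivalent: the supremum over feasible allocations x of Σ_{i=1}^K μ_i · 1{x_i ≥ θ_i} equals the supremum over feasible allocations x of Σ_{i=1}^K μ_i · 1{x_i ≥ θ̂_i}. -/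
/-- The largest network utility over feasible allocations is the value of an optimal solution
of the associated 0–1 knapsack problem. -/
theorem isGreatest_utility_of_knapsack_optimal {ι : Type*} [Fintype ι] {μ t : ι → ℝ} {C : ℝ}
    {S : Finset ι} (hμ : ∀ i, 0 ≤ μ i) (ht : ∀ i, 0 ≤ t i) (hfeas : ∑ i ∈ S, t i ≤ C)
    (hopt : ∀ T : Finset ι, ∑ i ∈ T, t i ≤ C → ∑ i ∈ T, μ i ≤ ∑ i ∈ S, μ i) :
    IsGreatest {u : ℝ | ∃ x : ι → ℝ, (∀ i, 0 ≤ x i) ∧ (∑ i, x i) ≤ C ∧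
      u = ∑ i, if t i ≤ x i then μ i else 0} (∑ i ∈ S, μ i) := by
  classical
  have upper (x : ι → ℝ) (hx : ∀ i, 0 ≤ x i) (hxC : ∑ i, x i ≤ C) :
      (∑ i, if t i ≤ x i then μ i else 0) ≤ ∑ i ∈ S, μ i := by
    rw [← Finset.sum_filter]
    refine hopt _ (le_trans ?_ hxC)
    rw [Finset.sum_filter]
    refine Finset.sum_le_sum fun i _ => ?_
    split_ifs with h
    exacts [h, hx i]
  refine ⟨?_, ?_⟩
  · have hx : ∀ i, 0 ≤ if i ∈ S then t i else 0 := fun i => by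
      split_ifs
      exacts [ht i, le_rfl]
    have hxC : (∑ i, if i ∈ S then t i else 0) ≤ C := by simpa using hfeas
    refine ⟨fun i => if i ∈ S then t i else 0, hx, hxC, le_antisymm ?_ (upper _ hx hxC)⟩
    rw [← Finset.sum_filter]
    refine Finset.sum_le_sum_of_subset_of_nonneg (fun i hi => ?_) fun i _ _ => hμ i
    simp [hi]
  · rintro u ⟨x, hx, hxC, rfl⟩
    exact upper x hx hxC

/-- Let `S⋆` be an optimal solution of the 0–1 knapsack problem with capacity
`C`, weights `θ` and values `μ`, let `γ = (C - ∑_{i ∈ S⋆} θ i) / K > 0`. If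
`θ i ≤ θ̂ i ≤ θ i + γ` for every `i`, then `θ` and `θ̂` are allocation equivalent: the
suprema over feasible allocations of the corresponding expected network utilities coincide. -/
theorem onum_perturbed_thresholds_allocation_equivalent
    (K : ℕ) (hK : 1 ≤ K) (μ : Fin K → ℝ) (hμ : ∀ i, μ i ∈ Set.Icc (0 : ℝ) 1)
    (θ : Fin K → ℝ) (hθ : ∀ i, 0 ≤ θ i) (C : ℝ) (hC : 0 ≤ C)
    (Sstar : Finset (Fin K)) (hfeas : (∑ i ∈ Sstar, θ i) ≤ C)
    (hopt : ∀ S : Finset (Fin K), (∑ i ∈ S, θ i) ≤ C → (∑ i ∈ S, μ i) ≤ ∑ i ∈ Sstar, μ i)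
    (γ : ℝ) (hγdef : γ = (C - ∑ i ∈ Sstar, θ i) / (K : ℝ)) (hγpos : 0 < γ)
    (θhat : Fin K → ℝ) (hθhat : ∀ i, θ i ≤ θhat i ∧ θhat i ≤ θ i + γ) :
    sSup {u : ℝ | ∃ x : Fin K → ℝ, (∀ i, 0 ≤ x i) ∧ (∑ i, x i) ≤ C ∧
        u = ∑ i, if θ i ≤ x i then μ i else 0} =
      sSup {u : ℝ | ∃ x : Fin K → ℝ, (∀ i, 0 ≤ x i) ∧ (∑ i, x i) ≤ C ∧
        u = ∑ i, if θhat i ≤ x i then μ i else 0} := by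
  have hKpos : (0 : ℝ) < K := by exact_mod_cast hK
  have hfeas_hat : ∑ i ∈ Sstar, θhat i ≤ C := by
    have hslack : (K : ℝ) * γ = C - ∑ i ∈ Sstar, θ i := by
      rw [hγdef, mul_div_cancel₀ _ hKpos.ne']
    have hcard : (Sstar.card : ℝ) ≤ K := by
      exact_mod_cast Sstar.card_le_univ.trans_eq (Fintype.card_fin K)
    calc ∑ i ∈ Sstar, θhat i ≤ ∑ i ∈ Sstar, (θ i + γ) :=
          Finset.sum_le_sum fun i _ => (hθhat i).2
      _ = ∑ i ∈ Sstar, θ i + Sstar.card * γ := by simp [Finset.sum_add_distrib]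
      _ ≤ ∑ i ∈ Sstar, θ i + K * γ := by gcongr
      _ = C := by rw [hslack]; ring
  have hopt_hat (T : Finset (Fin K)) (hT : ∑ i ∈ T, θhat i ≤ C) :
      ∑ i ∈ T, μ i ≤ ∑ i ∈ Sstar, μ i :=
    hopt T ((Finset.sum_le_sum fun i _ => (hθhat i).1).trans hT)
  rw [(isGreatest_utility_of_knapsack_optimal (fun i => (hμ i).1) hθ hfeas hopt).csSup_eq,
    (isGreatest_utility_of_knapsack_optimal (fun i => (hμ i).1)
      (fun i => (hθ i).trans (hθhat i).1) hfeas_hat hopt_hat).csSup_eq]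
end
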